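/- Let π and ν be two λ⊕⊸ proofs of the same sequent Γ ⊢ A. Then π and ν are equivalent (i.e., 𝒮(π) = 𝒮(ν)) if and only if their BDT slicings are equivalent, i.e., B(π) ∼ B(ν). -/

import Mathlib

/-- Formulas of the intuitionistic multiplicative-additive calculus λ⊕⊸:
atoms, labeled sums `⊕ₓ`, and linear implication `⊸`. -/
inductive Formula : Type
  | atom : ℕ → Formula
  | oplus : ℕ → Formula → Formula → Formula
  | limp : Formula → Formula → Formula
deriving DecidableEq

namespace Formula

/-- Number of atom occurrences of a formula. -/
def size : Formula → ℕ
  | atom _ => 1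
  | oplus _ A B => A.size + B.size
  | limp A B => A.size + B.size

/-- The list of Boolean-variable labels of the `⊕` occurrences of a formula. -/
def labels : Formula → List ℕ
  | atom _ => []
  | oplus x A B => x :: (A.labels ++ B.labels)
  | limp A B => A.labels ++ B.labels

end Formula

/-- Number of atom occurrences of a context. -/
def csz (Γ : List Formula) : ℕ := (Γ.map Formula.size).sum

/-- All labels of `⊕` occurrences of a sequent `Γ ⊢ C`. -/
def seqLabels (Γ : List Formula) (C : Formula) : List ℕ :=
  (Γ.map Formula.labels).flatten ++ C.labels

/-- Cut-free, η-expanded sequent calculus proofs of λ⊕⊸. -/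
inductive Proof : List Formula → Formula → Type
  | ax (a : ℕ) : Proof [.atom a] (.atom a)
  | limpR {Γ : List Formula} {A B : Formula} :
      Proof (Γ ++ [A]) B → Proof Γ (.limp A B)
  | limpL {Γ Δ : List Formula} {A B C : Formula} :
      Proof Γ A → Proof (B :: Δ) C → Proof (Γ ++ .limp A B :: Δ) C
  | ex (Γ₁ Γ₂ Γ₃ : List Formula) (A B : Formula) {C : Formula} :
      Proof (Γ₁ ++ A :: (Γ₂ ++ B :: Γ₃)) C → Proof (Γ₁ ++ B :: (Γ₂ ++ A :: Γ₃)) C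
  | oplusR1 (x : ℕ) {Γ : List Formula} {A B : Formula} :
      Proof Γ A → Proof Γ (.oplus x A B)
  | oplusR2 (x : ℕ) {Γ : List Formula} {A B : Formula} :
      Proof Γ B → Proof Γ (.oplus x A B)
  | oplusL (x : ℕ) {Γ : List Formula} {A B C : Formula} :
      Proof (Γ ++ [A]) C → Proof (Γ ++ [B]) C → Proof (Γ ++ [.oplus x A B]) C

/-- Atom occurrences of a sequent `Γ ⊢ C` are identified with the positions
`0, 1, 2, …` in the left-to-right flattening of `Γ` followed by `C`.
A slice is a finite set of unordered pairs of such positions. -/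
abbrev Slice := Finset (Sym2 ℕ)

/-- Reindexing the atom occurrences of a slice along a map of positions. -/
def Slice.reindex (f : ℕ → ℕ) (l : Slice) : Slice := l.image (Sym2.map f)

/-- Position reindex for the exchange rule: maps the positions of the layout
`[a-block][p-block][b-block][q-block]rest` to those of `[a-block][q-block][b-block][p-block]rest`. -/
def swapMap (a p b q : ℕ) (i : ℕ) : ℕ :=
  if i < a then i
  else if i < a + p then i + q + b
  else if i < a + p + b then i - p + q
  else if i < a + p + b + q then i - p - b
  else i

/-- The slicing 𝒮(π) of a λ⊕⊸ proof. -/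
def Proof.slicing : {Γ : List Formula} → {C : Formula} → Proof Γ C → Finset Slice
  | _, _, .ax _ => {({s(0, 1)} : Slice)}
  | _, _, .limpR p => p.slicing
  | _, _, @Proof.limpL Γ _ A _ _ p q =>
      Finset.image₂ (fun l m => l ∪ Slice.reindex (fun i => i + (csz Γ + A.size)) m)
        p.slicing q.slicing
  | _, _, @Proof.ex Γ₁ Γ₂ _ A B _ p =>
      p.slicing.image (Slice.reindex (swapMap (csz Γ₁) A.size (csz Γ₂) B.size))
  | _, _, .oplusR1 _ p => p.slicing
  | _, _, @Proof.oplusR2 _ Γ A _ p =>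
      p.slicing.image (Slice.reindex (fun i => if i < csz Γ then i else i + A.size))
  | _, _, @Proof.oplusL _ Γ A B _ p q =>
      p.slicing.image (Slice.reindex (fun i => if i < csz Γ + A.size then i else i + B.size))
      ∪ q.slicing.image (Slice.reindex (fun i => if i < csz Γ then i else i + A.size))

/-- Binary decision trees: leaves labeled `0`/`1` (as `Bool`), inner vertices labeled
by Boolean variables; `node x l r` has left subtree `l` and right subtree `r`. -/
inductive BDT : Type
  | leaf : Bool → BDT
  | node : ℕ → BDT → BDT → BDT
deriving DecidableEq

namespace BDT

/-- Evaluation of a BDT under a valuation: go left when the variable is `false` (0),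
right when it is `true` (1). -/
def eval (v : ℕ → Bool) : BDT → Bool
  | leaf b => b
  | node x l r => if v x then r.eval v else l.eval v

/-- Two BDTs are equivalent when they compute the same Boolean function. -/
def Equiv (φ ψ : BDT) : Prop := ∀ v : ℕ → Bool, φ.eval v = ψ.eval v

/-- Variables occurring in a BDT. -/
def vars : BDT → Finset ℕ
  | leaf _ => ∅
  | node x l r => insert x (l.vars ∪ r.vars)

/-- A BDT is free when no variable occurs twice on a path from the root to a leaf. -/
def Free : BDT → Prop
  | leaf _ => True
  | node x l r => x ∉ l.vars ∧ x ∉ r.vars ∧ l.Free ∧ r.Free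

/-- Negation of a BDT: swap the 0/1 labels at the leaves. -/
def neg : BDT → BDT
  | leaf b => leaf !b
  | node x l r => node x l.neg r.neg

end BDT

/-- The BDT slicing B(π) of a proof, as a function of two atom positions of the
conclusion sequent (it is symmetric in the two positions, and `0` on positions
that do not correspond to a pair of atoms of the sequent). -/
def Proof.bdt : {Γ : List Formula} → {C : Formula} → Proof Γ C → ℕ → ℕ → BDT
  | _, _, .ax _, i, j =>
      if (i = 0 ∧ j = 1) ∨ (i = 1 ∧ j = 0) then .leaf true else .leaf false
  | _, _, .limpR p, i, j => p.bdt i j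
  | _, _, @Proof.limpL Γ _ A _ _ p q, i, j =>
      if i < csz Γ + A.size ∧ j < csz Γ + A.size then p.bdt i j
      else if csz Γ + A.size ≤ i ∧ csz Γ + A.size ≤ j then
        q.bdt (i - (csz Γ + A.size)) (j - (csz Γ + A.size))
      else .leaf false
  | _, _, @Proof.ex Γ₁ Γ₂ _ A B _ p, i, j =>
      p.bdt (swapMap (csz Γ₁) B.size (csz Γ₂) A.size i)
            (swapMap (csz Γ₁) B.size (csz Γ₂) A.size j)
  | _, _, @Proof.oplusR1 _ Γ A _ p, i, j =>
      if i < csz Γ + A.size ∧ j < csz Γ + A.size then p.bdt i j else .leaf false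
  | _, _, @Proof.oplusR2 _ Γ A _ p, i, j =>
      if (i < csz Γ ∨ csz Γ + A.size ≤ i) ∧ (j < csz Γ ∨ csz Γ + A.size ≤ j) then
        p.bdt (if i < csz Γ then i else i - A.size) (if j < csz Γ then j else j - A.size)
      else .leaf false
  | _, _, @Proof.oplusL x Γ A B _ p q, i, j =>
      if ((csz Γ ≤ i ∧ i < csz Γ + A.size) ∧ (csz Γ + A.size ≤ j ∧ j < csz Γ + A.size + B.size)) ∨
         ((csz Γ ≤ j ∧ j < csz Γ + A.size) ∧ (csz Γ + A.size ≤ i ∧ i < csz Γ + A.size + B.size)) then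
        .leaf false
      else if (csz Γ ≤ i ∧ i < csz Γ + A.size) ∨ (csz Γ ≤ j ∧ j < csz Γ + A.size) then
        .node x (p.bdt (if i < csz Γ + A.size then i else i - B.size)
                       (if j < csz Γ + A.size then j else j - B.size)) (.leaf false)
      else if (csz Γ + A.size ≤ i ∧ i < csz Γ + A.size + B.size) ∨
              (csz Γ + A.size ≤ j ∧ j < csz Γ + A.size + B.size) then
        .node x (.leaf false) (q.bdt (if i < csz Γ then i else i - A.size)
                                     (if j < csz Γ then j else j - A.size))
      else
        .node x (p.bdt (if i < csz Γ + A.size then i else i - B.size)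
                       (if j < csz Γ + A.size then j else j - B.size))
                (q.bdt (if i < csz Γ then i else i - A.size)
                       (if j < csz Γ then j else j - A.size))

/-- Smaller element of an unordered pair of positions. -/
def pmin (p : Sym2 ℕ) : ℕ := Sym2.lift ⟨fun a b => min a b, fun a b => min_comm a b⟩ p
/-- Larger element of an unordered pair of positions. -/
def pmax (p : Sym2 ℕ) : ℕ := Sym2.lift ⟨fun a b => max a b, fun a b => max_comm a b⟩ p

/-- The BDT slicing B(π) at an unordered pair of atom positions. -/
def Proof.bdtAt {Γ : List Formula} {C : Formula} (π : Proof Γ C) (p : Sym2 ℕ) : BDT :=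
  π.bdt (pmin p) (pmax p)

/-- The slice obtained by evaluating the BDT slicing of `π` under a valuation `v`:
the set of pairs whose BDT evaluates to `1`. -/
def Proof.vslice {Γ : List Formula} {C : Formula} (π : Proof Γ C) (v : ℕ → Bool) :
    Set (Sym2 ℕ) :=
  {p : Sym2 ℕ | (π.bdtAt p).eval v = true}

/-- The labels of the `⊕†` rules of a proof (its Boolean variables). -/
def Proof.labels : {Γ : List Formula} → {C : Formula} → Proof Γ C → List ℕ
  | _, _, .ax _ => []
  | _, _, .limpR p => p.labels
  | _, _, .limpL p q => p.labels ++ q.labels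
  | _, _, .ex _ _ _ _ _ p => p.labels
  | _, _, .oplusR1 _ p => p.labels
  | _, _, .oplusR2 _ p => p.labels
  | _, _, .oplusL x p q => x :: (p.labels ++ q.labels)

/-- Number of rule occurrences of a proof. -/
def Proof.size : {Γ : List Formula} → {C : Formula} → Proof Γ C → ℕ
  | _, _, .ax _ => 1
  | _, _, .limpR p => p.size + 1
  | _, _, .limpL p q => p.size + q.size + 1
  | _, _, .ex _ _ _ _ _ p => p.size + 1
  | _, _, .oplusR1 _ p => p.size + 1
  | _, _, .oplusR2 _ p => p.size + 1
  | _, _, .oplusL x p q => p.size + q.size + 1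

/-! ### Positions touched by a slice -/

/-- The positions occurring in some pair of a slice. -/
def Slice.support (l : Slice) : Set ℕ := {i | ∃ j, s(i, j) ∈ l}

theorem Slice.mem_reindex {f g : ℕ → ℕ} (hgf : ∀ i, g (f i) = i) (l : Slice) (i j : ℕ) :
    s(i, j) ∈ l.reindex f ↔ f (g i) = i ∧ f (g j) = j ∧ s(g i, g j) ∈ l := by
  simp only [Slice.reindex, Finset.mem_image]
  constructor
  · rintro ⟨p, hp, h⟩
    induction p with
    | _ a b =>
      rw [Sym2.map_mk, Sym2.eq_iff] at h
      rcases h with ⟨rfl, rfl⟩ | ⟨rfl, rfl⟩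
      · simp [hgf, hp]
      · simp [hgf, Sym2.eq_swap, hp]
  · rintro ⟨hi, hj, h⟩
    exact ⟨_, h, by simp [hi, hj]⟩

theorem Slice.support_reindex (f : ℕ → ℕ) (l : Slice) :
    (l.reindex f).support = f '' l.support := by
  ext i
  simp only [Slice.support, Slice.reindex, Finset.mem_image, Set.mem_ofPred_eq, Set.mem_image]
  constructor
  · rintro ⟨j, p, hp, h⟩
    induction p with
    | _ a b =>
      rw [Sym2.map_mk, Sym2.eq_iff] at h
      rcases h with ⟨rfl, rfl⟩ | ⟨rfl, rfl⟩
      · exact ⟨a, ⟨b, hp⟩, rfl⟩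
      · exact ⟨b, ⟨a, Sym2.eq_swap ▸ hp⟩, rfl⟩
  · rintro ⟨a, ⟨b, hp⟩, rfl⟩
    exact ⟨f b, _, hp, by simp⟩

theorem Slice.support_union (l m : Slice) : (l ∪ m).support = l.support ∪ m.support := by
  ext i
  simp [Slice.support, exists_or]

@[simp] theorem csz_nil : csz [] = 0 := rfl

@[simp] theorem csz_cons (A : Formula) (Γ : List Formula) : csz (A :: Γ) = A.size + csz Γ := by
  simp [csz]

@[simp] theorem csz_append (Γ Δ : List Formula) : csz (Γ ++ Δ) = csz Γ + csz Δ := by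
  simp [csz]

theorem swapMap_swapMap (a p b q i : ℕ) : swapMap a q b p (swapMap a p b q i) = i := by
  unfold swapMap
  split_ifs <;> omega

/-! ### Evaluating a proof at a valuation -/

/-- The slice selected by a valuation, by recursion on the proof. -/
def Proof.evalSlice (v : ℕ → Bool) : {Γ : List Formula} → {C : Formula} → Proof Γ C → Slice
  | _, _, .ax _ => {s(0, 1)}
  | _, _, .limpR p => p.evalSlice v
  | _, _, @Proof.limpL Γ _ A _ _ p q =>
      p.evalSlice v ∪ Slice.reindex (fun i => i + (csz Γ + A.size)) (q.evalSlice v)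
  | _, _, @Proof.ex Γ₁ Γ₂ _ A B _ p =>
      Slice.reindex (swapMap (csz Γ₁) A.size (csz Γ₂) B.size) (p.evalSlice v)
  | _, _, .oplusR1 _ p => p.evalSlice v
  | _, _, @Proof.oplusR2 _ Γ A _ p =>
      Slice.reindex (fun i => if i < csz Γ then i else i + A.size) (p.evalSlice v)
  | _, _, @Proof.oplusL x Γ A B _ p q =>
      if v x then Slice.reindex (fun i => if i < csz Γ then i else i + A.size) (q.evalSlice v)
      else Slice.reindex (fun i => if i < csz Γ + A.size then i else i + B.size) (p.evalSlice v)

theorem Proof.lt_of_mem_support (v : ℕ → Bool) {Γ : List Formula} {C : Formula}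
    (π : Proof Γ C) : ∀ i ∈ (π.evalSlice v).support, i < csz Γ + C.size := by
  induction π with
  | ax a =>
    rintro i ⟨j, hj⟩
    simp [Proof.evalSlice, Formula.size] at hj ⊢
    omega
  | limpR p ih =>
    intro i hi
    have := ih i hi
    simp [Formula.size] at this ⊢
    omega
  | limpL p q ihp ihq =>
    intro i hi
    rw [Proof.evalSlice, Slice.support_union, Slice.support_reindex] at hi
    rcases hi with hi | ⟨k, hk, rfl⟩
    · have := ihp i hi
      simp [Formula.size] at this ⊢
      omega
    · have := ihq k hk
      simp [Formula.size] at this ⊢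
      omega
  | ex Γ₁ Γ₂ Γ₃ A B p ih =>
    intro i hi
    rw [Proof.evalSlice, Slice.support_reindex] at hi
    obtain ⟨k, hk, rfl⟩ := hi
    have := ih k hk
    simp [swapMap] at this ⊢
    split_ifs <;> omega
  | oplusR1 x p ih =>
    intro i hi
    have := ih i hi
    simp [Formula.size]
    omega
  | oplusR2 x p ih =>
    intro i hi
    rw [Proof.evalSlice, Slice.support_reindex] at hi
    obtain ⟨k, hk, rfl⟩ := hi
    have := ih k hk
    simp [Formula.size]
    split_ifs <;> omega
  | oplusL x p q ihp ihq =>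
    intro i hi
    rw [Proof.evalSlice] at hi
    split_ifs at hi <;> rw [Slice.support_reindex] at hi <;> obtain ⟨k, hk, rfl⟩ := hi
    · have := ihq k hk
      simp [Formula.size] at this ⊢
      split_ifs <;> omega
    · have := ihp k hk
      simp [Formula.size] at this ⊢
      split_ifs <;> omega

theorem Proof.lt_of_mem_evalSlice (v : ℕ → Bool) {Γ : List Formula} {C : Formula}
    (π : Proof Γ C) {i j : ℕ} (h : s(i, j) ∈ π.evalSlice v) :
    i < csz Γ + C.size ∧ j < csz Γ + C.size :=
  ⟨π.lt_of_mem_support v i ⟨j, h⟩, π.lt_of_mem_support v j ⟨i, Sym2.eq_swap ▸ h⟩⟩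

theorem Proof.eval_bdt (v : ℕ → Bool) {Γ : List Formula} {C : Formula} (π : Proof Γ C) :
    ∀ i j, (π.bdt i j).eval v = true ↔ s(i, j) ∈ π.evalSlice v := by
  induction π with
  | ax a =>
    intro i j
    simp only [Proof.bdt, Proof.evalSlice, Finset.mem_singleton, Sym2.eq_iff]
    split_ifs with h <;> simp [BDT.eval, h]
  | limpR p ih => exact ih
  | @limpL Γ Δ A B C p q ihp ihq =>
    intro i j
    have hp := p.lt_of_mem_evalSlice v (i := i) (j := j)
    rw [Proof.bdt, Proof.evalSlice, Finset.mem_union,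
      Slice.mem_reindex (g := fun i => i - (csz Γ + A.size)) (by simp), ← ihp, ← ihq]
    rw [← ihp] at hp
    split_ifs with h₁ h₂
    · refine ⟨Or.inl, ?_⟩
      rintro (h | ⟨h, -⟩)
      · exact h
      · omega
    · refine ⟨fun h => Or.inr ⟨by omega, by omega, h⟩, ?_⟩
      rintro (h | ⟨-, -, h⟩)
      · have := hp h
        omega
      · exact h
    · simp only [BDT.eval, Bool.false_eq_true, false_iff]
      rintro (h | ⟨h, h', -⟩)
      · exact h₁ (hp h)
      · omega
  | ex Γ₁ Γ₂ Γ₃ A B p ih =>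
    intro i j
    rw [Proof.bdt, Proof.evalSlice, Slice.mem_reindex (swapMap_swapMap _ _ _ _), ih]
    simp [swapMap_swapMap]
  | @oplusR1 x Γ A B p ih =>
    intro i j
    have hp := p.lt_of_mem_evalSlice v (i := i) (j := j)
    rw [Proof.bdt, Proof.evalSlice]
    split_ifs with h
    · exact ih i j
    · simpa [BDT.eval] using fun h' => h (hp h')
  | @oplusR2 x Γ A B p ih =>
    intro i j
    rw [Proof.bdt, Proof.evalSlice,
      Slice.mem_reindex (g := fun i => if i < csz Γ then i else i - A.size)
        (by intro i; split_ifs <;> omega), ← ih]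
    split_ifs <;> grind [BDT.eval]
  | @oplusL x Γ A B C p q ihp ihq =>
    intro i j
    rw [Proof.bdt, Proof.evalSlice]
    by_cases hx : v x = true
    · rw [if_pos hx,
        Slice.mem_reindex (g := fun i => if i < csz Γ then i else i - A.size)
          (by intro i; split_ifs <;> omega), ← ihq]
      split_ifs <;> simp [BDT.eval, hx] <;> grind
    · rw [if_neg hx,
        Slice.mem_reindex (g := fun i => if i < csz Γ + A.size then i else i - B.size)
          (by intro i; split_ifs <;> omega), ← ihp]
      split_ifs <;> simp [BDT.eval, hx] <;> grind

theorem Proof.eval_bdtAt (v : ℕ → Bool) {Γ : List Formula} {C : Formula} (π : Proof Γ C)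
    (p : Sym2 ℕ) : (π.bdtAt p).eval v = true ↔ p ∈ π.evalSlice v := by
  rw [Proof.bdtAt, Proof.eval_bdt]
  suffices s(pmin p, pmax p) = p by rw [this]
  induction p with
  | _ a b => rcases le_total a b with h | h <;> simp [pmin, pmax, h, Sym2.eq_swap]

/-! ### The slicing is the set of evaluations -/

theorem Proof.evalSlice_congr {Γ : List Formula} {C : Formula} (π : Proof Γ C)
    {v w : ℕ → Bool} (h : ∀ x ∈ seqLabels Γ C, v x = w x) :
    π.evalSlice v = π.evalSlice w := by
  induction π with
  | ax a => rfl
  | limpR p ih => exact ih fun x hx => h x (by simpa [seqLabels, Formula.labels] using hx)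
  | limpL p q ihp ihq =>
    rw [Proof.evalSlice, Proof.evalSlice,
      ihp fun x hx => h x (by simp [seqLabels, Formula.labels] at hx ⊢; grind),
      ihq fun x hx => h x (by simp [seqLabels, Formula.labels] at hx ⊢; grind)]
  | ex Γ₁ Γ₂ Γ₃ A B p ih =>
    rw [Proof.evalSlice, Proof.evalSlice,
      ih fun x hx => h x (by simp [seqLabels] at hx ⊢; grind)]
  | oplusR1 x p ih =>
    exact ih fun x hx => h x (by simp [seqLabels, Formula.labels] at hx ⊢; grind)
  | oplusR2 x p ih =>
    rw [Proof.evalSlice, Proof.evalSlice,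
      ih fun x hx => h x (by simp [seqLabels, Formula.labels] at hx ⊢; grind)]
  | oplusL x p q ihp ihq =>
    rw [Proof.evalSlice, Proof.evalSlice, h x (by simp [seqLabels, Formula.labels]),
      ihp fun x hx => h x (by simp [seqLabels, Formula.labels] at hx ⊢; grind),
      ihq fun x hx => h x (by simp [seqLabels, Formula.labels] at hx ⊢; grind)]

theorem Proof.mem_slicing {Γ : List Formula} {C : Formula} (π : Proof Γ C)
    (hlab : (seqLabels Γ C).Nodup) (l : Slice) :
    l ∈ π.slicing ↔ ∃ v, π.evalSlice v = l := by
  classical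
  induction π generalizing l with
  | ax a => simp [Proof.slicing, Proof.evalSlice, eq_comm]
  | limpR p ih => exact ih (by simpa [seqLabels, Formula.labels] using hlab) l
  | @limpL Γ Δ A B C p q ihp ihq =>
    have hperm : (seqLabels (Γ ++ .limp A B :: Δ) C) = seqLabels Γ A ++ seqLabels (B :: Δ) C := by
      simp [seqLabels, Formula.labels]
    rw [hperm, List.nodup_append'] at hlab
    obtain ⟨hp, hq, hd⟩ := hlab
    simp only [Proof.slicing, Finset.mem_image₂, Proof.evalSlice]
    constructor
    · rintro ⟨a, ha, b, hb, rfl⟩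
      obtain ⟨v, rfl⟩ := (ihp hp a).1 ha
      obtain ⟨w, rfl⟩ := (ihq hq b).1 hb
      refine ⟨fun x => if x ∈ seqLabels Γ A then v x else w x, ?_⟩
      rw [p.evalSlice_congr (w := v) fun x hx => by simp [hx],
        q.evalSlice_congr (w := w) fun x hx => if_neg fun h => hd h hx]
    · rintro ⟨v, rfl⟩
      exact ⟨_, (ihp hp _).2 ⟨v, rfl⟩, _, (ihq hq _).2 ⟨v, rfl⟩, rfl⟩
  | ex Γ₁ Γ₂ Γ₃ A B p ih =>
    rename_i C
    have hperm : (seqLabels (Γ₁ ++ B :: (Γ₂ ++ A :: Γ₃)) C).Perm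
        (seqLabels (Γ₁ ++ A :: (Γ₂ ++ B :: Γ₃)) C) := by
      rw [List.perm_iff_count]
      intro x
      simp [seqLabels]
      omega
    simp only [Proof.slicing, Proof.evalSlice, Finset.mem_image, ih (hperm.nodup_iff.1 hlab)]
    aesop
  | oplusR1 x p ih =>
    refine ih (hlab.sublist ?_) l
    simp [seqLabels, Formula.labels]
  | oplusR2 x p ih =>
    rename_i Γ A B
    have hsub : (seqLabels Γ B).Nodup := hlab.sublist <| (List.Sublist.refl _).append <|
      (List.sublist_append_right _ _).trans (List.sublist_cons_self _ _)
    simp only [Proof.slicing, Proof.evalSlice, Finset.mem_image, ih hsub]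
    aesop
  | @oplusL x Γ A B C p q ihp ihq =>
    have hperm : (seqLabels (Γ ++ [.oplus x A B]) C).Perm
        (x :: (seqLabels (Γ ++ [A]) C ++ B.labels)) := by
      rw [List.perm_iff_count]
      intro y
      simp [seqLabels, Formula.labels, List.count_cons]
      omega
    have hperm' : (seqLabels (Γ ++ [.oplus x A B]) C).Perm
        (x :: (seqLabels (Γ ++ [B]) C ++ A.labels)) := by
      rw [List.perm_iff_count]
      intro y
      simp [seqLabels, Formula.labels, List.count_cons]
      omega
    have hA := hperm.nodup_iff.1 hlab
    have hB := hperm'.nodup_iff.1 hlab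
    rw [List.nodup_cons, List.mem_append, not_or] at hA hB
    have hp := hA.2.sublist (List.sublist_append_left _ _)
    have hq := hB.2.sublist (List.sublist_append_left _ _)
    simp only [Proof.slicing, Proof.evalSlice, Finset.mem_union, Finset.mem_image, ihp hp, ihq hq]
    constructor
    · rintro (⟨a, ⟨v, rfl⟩, rfl⟩ | ⟨a, ⟨v, rfl⟩, rfl⟩)
      · refine ⟨Function.update v x false, ?_⟩
        rw [if_neg (by simp), p.evalSlice_congr (w := v)]
        intro y hy
        exact Function.update_of_ne (fun h : y = x => hA.1.1 (h ▸ hy)) _ _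
      · refine ⟨Function.update v x true, ?_⟩
        rw [if_pos (by simp), q.evalSlice_congr (w := v)]
        intro y hy
        exact Function.update_of_ne (fun h : y = x => hB.1.1 (h ▸ hy)) _ _
    · rintro ⟨v, rfl⟩
      split_ifs
      · exact Or.inr ⟨_, ⟨v, rfl⟩, rfl⟩
      · exact Or.inl ⟨_, ⟨v, rfl⟩, rfl⟩

/-! ### Every formula of the context is touched -/

/-- The set `T` of positions meets the block of every formula of `Γ`,
when the blocks are laid out from position `o` on. -/
def MeetsAll (T : Set ℕ) : ℕ → List Formula → Prop
  | _, [] => True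
  | o, A :: Γ => (∃ i ∈ T, o ≤ i ∧ i < o + A.size) ∧ MeetsAll T (o + A.size) Γ

theorem meetsAll_append (T : Set ℕ) (o : ℕ) (Γ Δ : List Formula) :
    MeetsAll T o (Γ ++ Δ) ↔ MeetsAll T o Γ ∧ MeetsAll T (o + csz Γ) Δ := by
  induction Γ generalizing o with
  | nil => simp [MeetsAll]
  | cons A Γ ih => simp [MeetsAll, ih, and_assoc, add_assoc]

theorem MeetsAll.transport {T T' : Set ℕ} {o o' : ℕ} {Γ : List Formula} (h : MeetsAll T o Γ)
    (hT : ∀ i ∈ T, o ≤ i → i < o + csz Γ → ∃ i' ∈ T', i' + o = i + o') :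
    MeetsAll T' o' Γ := by
  induction Γ generalizing o o' with
  | nil => trivial
  | cons A Γ ih =>
    simp only [csz_cons] at hT
    obtain ⟨⟨i, hi, h₁, h₂⟩, h⟩ := h
    obtain ⟨i', hi', h'⟩ := hT i hi h₁ (by omega)
    refine ⟨⟨i', hi', by omega, by omega⟩, ih h fun k hk h₁ h₂ => ?_⟩
    obtain ⟨k', hk', h'⟩ := hT k hk (by omega) (by omega)
    exact ⟨k', hk', by omega⟩

theorem Proof.meetsAll_support (v : ℕ → Bool) {Γ : List Formula} {C : Formula}
    (π : Proof Γ C) : MeetsAll (π.evalSlice v).support 0 Γ := by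
  induction π with
  | ax a => exact ⟨⟨0, ⟨1, by simp [Proof.evalSlice]⟩, by simp [Formula.size]⟩, trivial⟩
  | limpR p ih => exact ((meetsAll_append _ _ _ _).1 ih).1
  | limpL p q ihp ihq =>
    rw [Proof.evalSlice, Slice.support_union, Slice.support_reindex]
    simp only [meetsAll_append, MeetsAll, Formula.size] at ihp ihq ⊢
    obtain ⟨⟨i, hi, h₁, h₂⟩, hq⟩ := ihq
    refine ⟨ihp.transport fun i hi _ _ => ⟨i, Or.inl hi, rfl⟩,
      ⟨_, Or.inr ⟨i, hi, rfl⟩, ?_, ?_⟩,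
      hq.transport fun i hi _ _ => ⟨_, Or.inr ⟨i, hi, rfl⟩, ?_⟩⟩ <;> dsimp only <;> omega
  | ex Γ₁ Γ₂ Γ₃ A B p ih =>
    rw [Proof.evalSlice, Slice.support_reindex]
    simp only [meetsAll_append, MeetsAll] at ih ⊢
    obtain ⟨h₁, ⟨a, ha, ha'⟩, h₂, ⟨b, hb, hb'⟩, h₃⟩ := ih
    refine ⟨h₁.transport fun i hi _ _ => ⟨_, ⟨i, hi, rfl⟩, ?_⟩,
      ⟨_, ⟨b, hb, rfl⟩, ?_⟩,
      h₂.transport fun i hi _ _ => ⟨_, ⟨i, hi, rfl⟩, ?_⟩,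
      ⟨_, ⟨a, ha, rfl⟩, ?_⟩,
      h₃.transport fun i hi _ _ => ⟨_, ⟨i, hi, rfl⟩, ?_⟩⟩ <;>
      unfold swapMap <;> split_ifs <;> omega
  | oplusR1 x p ih => exact ih
  | oplusR2 x p ih =>
    rw [Proof.evalSlice, Slice.support_reindex]
    refine ih.transport fun i hi _ _ => ⟨_, ⟨i, hi, rfl⟩, ?_⟩
    dsimp only
    split_ifs <;> omega
  | oplusL x p q ihp ihq =>
    rw [Proof.evalSlice]
    simp only [meetsAll_append, MeetsAll, Formula.size] at ihp ihq ⊢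
    split_ifs <;> rw [Slice.support_reindex]
    · obtain ⟨h, ⟨a, ha, ha'⟩, -⟩ := ihq
      refine ⟨h.transport fun i hi _ _ => ⟨_, ⟨i, hi, rfl⟩, ?_⟩, ⟨_, ⟨a, ha, rfl⟩, ?_⟩, trivial⟩ <;>
        dsimp only <;> split_ifs <;> omega
    · obtain ⟨h, ⟨a, ha, ha'⟩, -⟩ := ihp
      refine ⟨h.transport fun i hi _ _ => ⟨_, ⟨i, hi, rfl⟩, ?_⟩, ⟨_, ⟨a, ha, rfl⟩, ?_⟩, trivial⟩ <;>
        dsimp only <;> split_ifs <;> omega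

/-! ### Guards -/

/-- For every atom occurrence of a formula, the list of pairs `(x, b)` such that the
occurrence lies in the side `b` (`false` for left) of a sum labeled `x` of negative polarity;
`neg` tells whether the formula itself is in negative position. -/
def Formula.guards : Bool → Formula → List (List (ℕ × Bool))
  | _, atom _ => [[]]
  | true, oplus x A B =>
      (A.guards true).map (List.cons (x, false)) ++ (B.guards true).map (List.cons (x, true))
  | false, oplus _ A B => A.guards false ++ B.guards false
  | neg, limp A B => A.guards (!neg) ++ B.guards neg

@[simp] theorem Formula.length_guards (neg : Bool) (A : Formula) :
    (A.guards neg).length = A.size := by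
  induction A generalizing neg with
  | atom a => simp [guards, size]
  | oplus x A B ihA ihB => cases neg <;> simp [guards, size, ihA, ihB]
  | limp A B ihA ihB => simp [guards, size, ihA, ihB]

/-- The guards of the atom occurrences of a context. -/
def ctxGuards (Γ : List Formula) : List (List (ℕ × Bool)) :=
  (Γ.map (Formula.guards true)).flatten

@[simp] theorem length_ctxGuards (Γ : List Formula) : (ctxGuards Γ).length = csz Γ := by
  induction Γ with
  | nil => rfl
  | cons A Γ ih => simp_all [ctxGuards]

@[simp] theorem ctxGuards_append (Γ Δ : List Formula) :
    ctxGuards (Γ ++ Δ) = ctxGuards Γ ++ ctxGuards Δ := by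
  simp [ctxGuards]

@[simp] theorem ctxGuards_cons (A : Formula) (Γ : List Formula) :
    ctxGuards (A :: Γ) = A.guards true ++ ctxGuards Γ := by
  simp [ctxGuards]

@[simp] theorem ctxGuards_nil : ctxGuards [] = [] := rfl

/-- The guards of the atom occurrences of a sequent. -/
def seqGuards (Γ : List Formula) (C : Formula) : List (List (ℕ × Bool)) :=
  ctxGuards Γ ++ C.guards false

/-- The valuation `v` satisfies the guards `L` of all positions in `T`. -/
def Satisfies (v : ℕ → Bool) (L : List (List (ℕ × Bool))) (T : Set ℕ) : Prop :=
  ∀ i ∈ T, ∀ s, L[i]? = some s → ∀ y ∈ s, v y.1 = y.2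

theorem satisfies_union (v : ℕ → Bool) (L : List (List (ℕ × Bool))) (S T : Set ℕ) :
    Satisfies v L (S ∪ T) ↔ Satisfies v L S ∧ Satisfies v L T := by
  simp only [Satisfies, Set.mem_union, or_imp, forall_and]

theorem satisfies_image {v : ℕ → Bool} {L L' : List (List (ℕ × Bool))} {f : ℕ → ℕ} {T : Set ℕ}
    (h : ∀ i ∈ T, L'[f i]? = L[i]?) : Satisfies v L' (f '' T) ↔ Satisfies v L T := by
  simp only [Satisfies, Set.forall_mem_image]
  exact forall₂_congr fun i hi => by rw [h i hi]

theorem satisfies_append_left {v : ℕ → Bool} {L L' : List (List (ℕ × Bool))} {T : Set ℕ}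
    (hT : ∀ i ∈ T, i < L.length) : Satisfies v (L ++ L') T ↔ Satisfies v L T := by
  have := satisfies_image (v := v) (f := id) (L' := L ++ L') (L := L) (T := T)
    fun i hi => List.getElem?_append_left (hT i hi)
  simpa using this

theorem satisfies_limpL (v : ℕ → Bool) {Γ Δ : List Formula} {A B C : Formula} {S T : Set ℕ}
    (hS : ∀ i ∈ S, i < csz Γ + A.size) :
    Satisfies v (seqGuards (Γ ++ .limp A B :: Δ) C)
      (S ∪ (fun i => i + (csz Γ + A.size)) '' T) ↔
    Satisfies v (seqGuards Γ A) S ∧ Satisfies v (seqGuards (B :: Δ) C) T := by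
  have e : seqGuards (Γ ++ .limp A B :: Δ) C = seqGuards Γ A ++ seqGuards (B :: Δ) C := by
    simp [seqGuards, Formula.guards]
  rw [e, satisfies_union, satisfies_append_left (by simpa [seqGuards] using hS)]
  refine and_congr_right' (satisfies_image fun i _ => ?_)
  rw [List.getElem?_append_right (by simp [seqGuards])]
  simp [seqGuards]

theorem getElem?_swapMap {α : Type*} (a p b q r : List α) (i : ℕ) :
    (a ++ (q ++ (b ++ (p ++ r))))[swapMap a.length p.length b.length q.length i]? =
      (a ++ (p ++ (b ++ (q ++ r))))[i]? := by
  simp only [swapMap, List.getElem?_append]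
  split_ifs <;> first | omega | (congr 1 <;> omega)

theorem satisfies_ex (v : ℕ → Bool) (Γ₁ Γ₂ Γ₃ : List Formula) (A B C : Formula) (T : Set ℕ) :
    Satisfies v (seqGuards (Γ₁ ++ B :: (Γ₂ ++ A :: Γ₃)) C)
      (swapMap (csz Γ₁) A.size (csz Γ₂) B.size '' T) ↔
    Satisfies v (seqGuards (Γ₁ ++ A :: (Γ₂ ++ B :: Γ₃)) C) T := by
  refine satisfies_image fun i _ => ?_
  have := getElem?_swapMap (ctxGuards Γ₁) (A.guards true) (ctxGuards Γ₂) (B.guards true)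
    (ctxGuards Γ₃ ++ C.guards false) i
  simpa [seqGuards] using this

theorem satisfies_oplusR1 (v : ℕ → Bool) (x : ℕ) {Γ : List Formula} {A B : Formula} {T : Set ℕ}
    (hT : ∀ i ∈ T, i < csz Γ + A.size) :
    Satisfies v (seqGuards Γ (.oplus x A B)) T ↔ Satisfies v (seqGuards Γ A) T := by
  have e : seqGuards Γ (.oplus x A B) = seqGuards Γ A ++ B.guards false := by
    simp [seqGuards, Formula.guards]
  rw [e, satisfies_append_left (by simpa [seqGuards] using hT)]

theorem satisfies_oplusR2 (v : ℕ → Bool) (x : ℕ) (Γ : List Formula) (A B : Formula) (T : Set ℕ) :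
    Satisfies v (seqGuards Γ (.oplus x A B))
      ((fun i => if i < csz Γ then i else i + A.size) '' T) ↔
    Satisfies v (seqGuards Γ B) T := by
  refine satisfies_image fun i _ => ?_
  simp only [seqGuards, Formula.guards, List.getElem?_append, length_ctxGuards,
    Formula.length_guards]
  split_ifs <;> first | omega | rfl | (congr 1; omega)

theorem satisfies_image_map_cons (v : ℕ → Bool) (x : ℕ) (b : Bool)
    {L L' : List (List (ℕ × Bool))} {f : ℕ → ℕ} {T : Set ℕ} {m n : ℕ} (hn : n ≤ L.length)
    (hin : ∀ i ∈ T, m ≤ i → i < n → L'[f i]? = L[i]?.map (List.cons (x, b)))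
    (hout : ∀ i ∈ T, ¬(m ≤ i ∧ i < n) → L'[f i]? = L[i]?) :
    Satisfies v L' (f '' T) ↔
      Satisfies v L T ∧ ((∃ i ∈ T, m ≤ i ∧ i < n) → v x = b) := by
  simp only [Satisfies, Set.forall_mem_image]
  constructor
  · intro h
    refine ⟨fun i hi s hs y hy => ?_, ?_⟩
    · by_cases hi' : m ≤ i ∧ i < n
      · exact h hi (_ :: s) (by rw [hin i hi hi'.1 hi'.2, hs]; rfl) y (by simp [hy])
      · exact h hi s (by rw [hout i hi hi', hs]) y hy
    · rintro ⟨i, hi, h₁, h₂⟩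
      exact h hi ((x, b) :: L[i]) (by
        rw [hin i hi h₁ h₂, List.getElem?_eq_getElem (h₂.trans_le hn)]; rfl) (x, b) (by simp)
  · rintro ⟨h, hx⟩ i hi s hs y hy
    by_cases hi' : m ≤ i ∧ i < n
    · rw [hin i hi hi'.1 hi'.2, Option.map_eq_some_iff] at hs
      obtain ⟨t, ht, rfl⟩ := hs
      rcases List.mem_cons.1 hy with rfl | hy
      · exact hx ⟨i, hi, hi'⟩
      · exact h i hi t ht y hy
    · exact h i hi s (by rw [← hout i hi hi', hs]) y hy

theorem satisfies_oplusL_left (v : ℕ → Bool) (x : ℕ) (Γ : List Formula) (A B C : Formula)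
    (T : Set ℕ) :
    Satisfies v (seqGuards (Γ ++ [.oplus x A B]) C)
      ((fun i => if i < csz Γ + A.size then i else i + B.size) '' T) ↔
    Satisfies v (seqGuards (Γ ++ [A]) C) T ∧
      ((∃ i ∈ T, csz Γ ≤ i ∧ i < csz Γ + A.size) → v x = false) := by
  refine satisfies_image_map_cons v x false (by simp [seqGuards]) ?_ ?_
  all_goals
    intros
    simp only [seqGuards, ctxGuards_append, ctxGuards_cons, ctxGuards_nil, List.append_nil,
      Formula.guards, List.append_assoc, List.getElem?_append, List.length_map,
      length_ctxGuards, Formula.length_guards, List.getElem?_map]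
    split_ifs <;> first | omega | rfl | (congr 1; omega)

theorem satisfies_oplusL_right (v : ℕ → Bool) (x : ℕ) (Γ : List Formula) (A B C : Formula)
    (T : Set ℕ) :
    Satisfies v (seqGuards (Γ ++ [.oplus x A B]) C)
      ((fun i => if i < csz Γ then i else i + A.size) '' T) ↔
    Satisfies v (seqGuards (Γ ++ [B]) C) T ∧
      ((∃ i ∈ T, csz Γ ≤ i ∧ i < csz Γ + B.size) → v x = true) := by
  refine satisfies_image_map_cons v x true (by simp [seqGuards]) ?_ ?_
  all_goals
    intros
    simp only [seqGuards, ctxGuards_append, ctxGuards_cons, ctxGuards_nil, List.append_nil,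
      Formula.guards, List.append_assoc, List.getElem?_append, List.length_map,
      length_ctxGuards, Formula.length_guards, List.getElem?_map]
    split_ifs <;> first | omega | rfl | (congr 1; omega) | (congr 2; omega)

theorem seqGuards_limp (Γ : List Formula) (A B : Formula) :
    seqGuards Γ (.limp A B) = seqGuards (Γ ++ [A]) B := by
  simp [seqGuards, Formula.guards]

/-- A valuation satisfies the guards of the slice it selects. -/
theorem Proof.satisfies_evalSlice (v : ℕ → Bool) {Γ : List Formula} {C : Formula}
    (π : Proof Γ C) : Satisfies v (seqGuards Γ C) (π.evalSlice v).support := by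
  induction π with
  | ax a =>
    intro i _ s hs
    have := List.mem_of_getElem? hs
    simp [seqGuards, Formula.guards] at this
    simp [this]
  | limpR p ih => rwa [seqGuards_limp]
  | limpL p q ihp ihq =>
    rw [Proof.evalSlice, Slice.support_union, Slice.support_reindex,
      satisfies_limpL v (p.lt_of_mem_support v)]
    exact ⟨ihp, ihq⟩
  | ex Γ₁ Γ₂ Γ₃ A B p ih =>
    rwa [Proof.evalSlice, Slice.support_reindex, satisfies_ex]
  | oplusR1 x p ih => exact (satisfies_oplusR1 v x (p.lt_of_mem_support v)).2 ih
  | oplusR2 x p ih => rwa [Proof.evalSlice, Slice.support_reindex, satisfies_oplusR2]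
  | oplusL x p q ihp ihq =>
    rw [Proof.evalSlice]
    split_ifs with hx <;> rw [Slice.support_reindex]
    · exact (satisfies_oplusL_right ..).2 ⟨ihq, fun _ => hx⟩
    · exact (satisfies_oplusL_left ..).2 ⟨ihp, fun _ => by simpa using hx⟩

/-- A slice is selected by every valuation that satisfies its guards. -/
theorem Proof.evalSlice_eq_of_satisfies {v w : ℕ → Bool} {Γ : List Formula} {C : Formula}
    (π : Proof Γ C) (h : Satisfies v (seqGuards Γ C) (π.evalSlice w).support) :
    π.evalSlice v = π.evalSlice w := by
  induction π with
  | ax a => rfl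
  | limpR p ih => exact ih (by rwa [seqGuards_limp] at h)
  | limpL p q ihp ihq =>
    rw [Proof.evalSlice, Slice.support_union, Slice.support_reindex,
      satisfies_limpL v (p.lt_of_mem_support w)] at h
    rw [Proof.evalSlice, Proof.evalSlice, ihp h.1, ihq h.2]
  | ex Γ₁ Γ₂ Γ₃ A B p ih =>
    rw [Proof.evalSlice, Slice.support_reindex, satisfies_ex] at h
    rw [Proof.evalSlice, Proof.evalSlice, ih h]
  | oplusR1 x p ih => exact ih ((satisfies_oplusR1 v x (p.lt_of_mem_support w)).1 h)
  | oplusR2 x p ih =>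
    rw [Proof.evalSlice, Slice.support_reindex, satisfies_oplusR2] at h
    rw [Proof.evalSlice, Proof.evalSlice, ih h]
  | oplusL x p q ihp ihq =>
    by_cases hx : w x = true
    · rw [Proof.evalSlice, if_pos hx, Slice.support_reindex, satisfies_oplusL_right] at h
      have ht := ((meetsAll_append _ _ _ _).1 (q.meetsAll_support w)).2.1
      rw [Proof.evalSlice, Proof.evalSlice, if_pos hx, if_pos (h.2 (by simpa using ht)), ihq h.1]
    · rw [Proof.evalSlice, if_neg hx, Slice.support_reindex, satisfies_oplusL_left] at h
      have ht := ((meetsAll_append _ _ _ _).1 (p.meetsAll_support w)).2.1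
      rw [Proof.evalSlice, Proof.evalSlice, if_neg hx,
        if_neg (by simp [h.2 (by simpa using ht)]), ihp h.1]

/-- **Proof equivalence via BDT slicings.**  Let `π` and `ν` be two λ⊕⊸ proofs of the same
sequent `Γ ⊢ C` (with, as always, distinct labels on the `⊕` occurrences of the sequent).
Then `π ∼ ν` — i.e. `𝒮(π) = 𝒮(ν)` — if and only if their BDT slicings are equivalent,
i.e. `B(π)[α,β] ∼ B(ν)[α,β]` for every unordered pair of atom occurrences. -/
theorem proof_equiv_iff_bdt_slicing_equiv
    (Γ : List Formula) (C : Formula) (hlab : (seqLabels Γ C).Nodup)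
    (π ν : Proof Γ C) :
    π.slicing = ν.slicing ↔ ∀ p : Sym2 ℕ, BDT.Equiv (π.bdtAt p) (ν.bdtAt p) := by
  constructor
  · intro h p v
    rw [Bool.eq_iff_iff, π.eval_bdtAt, ν.eval_bdtAt]
    obtain ⟨w, hw⟩ := (ν.mem_slicing hlab _).1 (h ▸ (π.mem_slicing hlab _).2 ⟨v, rfl⟩)
    rw [ν.evalSlice_eq_of_satisfies (w := w) (hw ▸ π.satisfies_evalSlice v), hw]
  · intro h
    have hv : ∀ v, π.evalSlice v = ν.evalSlice v := fun v => by
      ext p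
      rw [← π.eval_bdtAt, ← ν.eval_bdtAt, h p v]
    ext l
    simp only [π.mem_slicing hlab, ν.mem_slicing hlab, hv]
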